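/- Let M be a compact metric space, f a continuous flow on M, and A a continuous linear cocycle over f on M × ℝ^k. Let ν be an f-invariant ergodic Borel probability measure, γ : M → (0,∞) continuous, g the time change of f with speed multiplier γ, and τ the additive cocycle over g generated by γ; the time-changed cocycle over g is B^t_x = A^{τ(t,x)}_x. Fix 1 ≤ i ≤ k and λ ∈ ℝ, and suppose that for ν-almost every x ∈ M, lim_{t→∞} (1/t) log σ_i(A^t_x) = λ. Then for ν^γ-almost every x ∈ M, lim_{n→∞, n∈ℕ} (1/n) log σ_i(B^n_x) = λ · (∫_M γ^{−1} dν)^{−1}. -/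

import Mathlib

open MeasureTheory intervalIntegral Filter Topology Module

/-- The `i`-th singular value (one-based, increasing order) of a linear map between real
inner product spaces, via the Courant–Fischer min-max characterization. -/
noncomputable def singularValue {U W : Type*} [NormedAddCommGroup U] [InnerProductSpace ℝ U]
    [NormedAddCommGroup W] [InnerProductSpace ℝ W] (T : U →ₗ[ℝ] W) (i : ℕ) : ℝ :=
  sInf {c : ℝ | ∃ V : Submodule ℝ U, finrank ℝ V = i ∧
    c = sSup {r : ℝ | ∃ v ∈ V, ‖v‖ = 1 ∧ r = ‖T v‖}}

/-- The additive cocycle over the flow `g` generated by `γ`: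
`τ(t,x) = ∫₀^t γ(g^s x) ds`. -/
noncomputable def addCocycle {M : Type*} [TopologicalSpace M] (g : Flow ℝ M) (γ : M → ℝ)
    (t : ℝ) (x : M) : ℝ :=
  ∫ s in (0 : ℝ)..t, γ (g s x)

/-- The flow `g` is a time change of `f` with speed multiplier `γ`. -/
def IsTimeChange {M : Type*} [TopologicalSpace M] (f g : Flow ℝ M) (γ : M → ℝ) : Prop :=
  ∀ t x, g t x = f (addCocycle g γ t x) x

/-- The measure `ν^γ`, with Radon–Nikodym derivative
`dν^γ/dν = γ⁻¹ · (∫ γ⁻¹ dν)⁻¹`. -/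
noncomputable def nuGamma {M : Type*} [MeasurableSpace M] (ν : Measure M) (γ : M → ℝ) :
    Measure M :=
  ν.withDensity fun x => ENNReal.ofReal ((γ x)⁻¹ / ∫ y, (γ y)⁻¹ ∂ν)

/-- The maximum of `0` and the first `n` Birkhoff sums of `ψ` under `T`. -/
noncomputable def maxBirkhoffSum {M : Type*} (T : M → M) (ψ : M → ℝ) : ℕ → M → ℝ
  | 0 => fun _ => 0
  | n + 1 => fun x => max (ψ x + maxBirkhoffSum T ψ n (T x)) 0

section MaximalErgodic

variable {M : Type*} {T : M → M} {ψ : M → ℝ}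

lemma maxBirkhoffSum_nonneg (n : ℕ) (x : M) : 0 ≤ maxBirkhoffSum T ψ n x := by
  cases n with
  | zero => exact le_rfl
  | succ n => exact le_max_right _ _

lemma maxBirkhoffSum_le_succ (n : ℕ) (x : M) :
    maxBirkhoffSum T ψ n x ≤ maxBirkhoffSum T ψ (n + 1) x := by
  induction n generalizing x with
  | zero => exact maxBirkhoffSum_nonneg 1 x
  | succ n ih => exact max_le_max (by linarith [ih (T x)]) le_rfl

variable [MeasurableSpace M] {ν : Measure M}

lemma measurable_maxBirkhoffSum (hT : Measurable T) (hψ : Measurable ψ) (n : ℕ) :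
    Measurable (maxBirkhoffSum T ψ n) := by
  induction n with
  | zero => exact measurable_const
  | succ n ih => exact (hψ.add (ih.comp hT)).max measurable_const

lemma integrable_maxBirkhoffSum (hT : MeasurePreserving T ν ν) (hψ : Integrable ψ ν) (n : ℕ) :
    Integrable (maxBirkhoffSum T ψ n) ν := by
  induction n with
  | zero => exact integrable_zero _ _ _
  | succ n ih => exact (hψ.add (hT.integrable_comp_of_integrable ih)).pos_part

/-- The maximal ergodic inequality, over finitely many Birkhoff sums. -/
lemma setIntegral_maxBirkhoffSum_pos_nonneg (hT : MeasurePreserving T ν ν)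
    (hm : Measurable ψ) (hψ : Integrable ψ ν) (n : ℕ) :
    0 ≤ ∫ x in {x | 0 < maxBirkhoffSum T ψ n x}, ψ x ∂ν := by
  have hM := measurable_maxBirkhoffSum hT.measurable hm n
  have hI := integrable_maxBirkhoffSum hT hψ n
  have hIT : Integrable (fun x => maxBirkhoffSum T ψ n (T x)) ν :=
    hT.integrable_comp_of_integrable hI
  have hs : MeasurableSet {x | 0 < maxBirkhoffSum T ψ n x} :=
    measurableSet_lt measurable_const hM
  have hTint : ∫ x, maxBirkhoffSum T ψ n (T x) ∂ν = ∫ x, maxBirkhoffSum T ψ n x ∂ν := by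
    rw [← integral_map hT.measurable.aemeasurable
      (hM.aestronglyMeasurable), hT.map_eq]
  rw [← MeasureTheory.integral_indicator hs]
  have hle : ∫ x, (maxBirkhoffSum T ψ n x - maxBirkhoffSum T ψ n (T x)) ∂ν ≤
      ∫ x, Set.indicator {x | 0 < maxBirkhoffSum T ψ n x} ψ x ∂ν := by
    refine integral_mono (hI.sub hIT) (hψ.indicator hs) fun x => ?_
    by_cases hx : 0 < maxBirkhoffSum T ψ n x
    · rw [Set.indicator_of_mem (by exact hx)]
      cases n with
      | zero => exact absurd hx (lt_irrefl _)
      | succ n =>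
        have h1 := maxBirkhoffSum_le_succ (T := T) (ψ := ψ) n (T x)
        have h2 : maxBirkhoffSum T ψ (n + 1) x = ψ x + maxBirkhoffSum T ψ n (T x) := by
          rcases max_choice (ψ x + maxBirkhoffSum T ψ n (T x)) 0 with h | h
          · exact h
          · exact absurd (h ▸ hx : (0 : ℝ) < 0) (lt_irrefl _)
        simp only
        linarith
    · rw [Set.indicator_of_notMem (by exact hx)]
      have := maxBirkhoffSum_nonneg (T := T) (ψ := ψ) n (T x)
      simp only
      linarith
  rw [integral_sub hI hIT, hTint, sub_self] at hle
  exact hle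

/-- If almost every point has a positive Birkhoff sum then the integral is nonnegative. -/
lemma integral_nonneg_of_ae_exists_maxBirkhoffSum_pos (hT : MeasurePreserving T ν ν)
    (hm : Measurable ψ) (hψ : Integrable ψ ν)
    (h : ∀ᵐ x ∂ν, ∃ n, 0 < maxBirkhoffSum T ψ n x) : 0 ≤ ∫ x, ψ x ∂ν := by
  have hmono : Monotone fun n => {x | 0 < maxBirkhoffSum T ψ n x} :=
    monotone_nat_of_le_succ fun n x hx => lt_of_lt_of_le hx (maxBirkhoffSum_le_succ n x)
  have ht := tendsto_setIntegral_of_monotone (μ := ν) (f := ψ)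
    (fun n => measurableSet_lt measurable_const (measurable_maxBirkhoffSum hT.measurable hm n))
    hmono hψ.integrableOn
  have hU : (⋃ n, {x | 0 < maxBirkhoffSum T ψ n x}) =ᵐ[ν] Set.univ := by
    rw [eventuallyEq_univ]
    filter_upwards [h] with x hx
    simpa using hx
  rw [setIntegral_congr_set hU, setIntegral_univ] at ht
  exact ge_of_tendsto' ht fun n => setIntegral_maxBirkhoffSum_pos_nonneg hT hm hψ n

end MaximalErgodic

section FlowIntegrals

variable {M : Type*} [TopologicalSpace M] {f g : Flow ℝ M} {h γ : M → ℝ}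

lemma Continuous.exists_abs_le [CompactSpace M] (hh : Continuous h) : ∃ C, ∀ x, |h x| ≤ C := by
  obtain ⟨C, hC⟩ := isCompact_univ.exists_bound_of_continuousOn hh.continuousOn
  exact ⟨C, fun x => hC x trivial⟩

lemma continuous_comp_flow (hh : Continuous h) (x : M) : Continuous fun s => h (f s x) :=
  hh.comp (f.continuous continuous_id continuous_const)

lemma addCocycle_add (hh : Continuous h) (s t : ℝ) (x : M) :
    addCocycle f h (s + t) x = addCocycle f h s x + addCocycle f h t (f s x) := by
  have hc := continuous_comp_flow (f := f) hh x
  have hshift : ∀ u, h (f u (f s x)) = h (f (u + s) x) := fun u => by rw [f.map_add]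
  simp only [addCocycle, hshift]
  rw [intervalIntegral.integral_comp_add_right (fun u => h (f u x)), zero_add, add_comm t s,
    intervalIntegral.integral_add_adjacent_intervals (hc.intervalIntegrable _ _)
      (hc.intervalIntegrable _ _)]

lemma abs_addCocycle_le {C : ℝ} (hC : ∀ x, |h x| ≤ C) (t : ℝ) (x : M) :
    |addCocycle f h t x| ≤ C * |t| := by
  have := intervalIntegral.norm_integral_le_of_norm_le_const
    (a := 0) (b := t) (f := fun s => h (f s x)) (C := C) fun s _ => hC _
  simpa [addCocycle] using this

lemma continuous_addCocycle (hh : Continuous h) (t : ℝ) : Continuous (addCocycle f h t) := by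
  refine intervalIntegral.continuous_parametric_intervalIntegral_of_continuous'
    (f := fun x s => h (f s x)) ?_ 0 t
  exact hh.comp (f.continuous continuous_snd continuous_fst)

lemma hasDerivAt_addCocycle (hh : Continuous h) (t : ℝ) (x : M) :
    HasDerivAt (fun t => addCocycle f h t x) (h (f t x)) t :=
  ((continuous_comp_flow hh x).integral_hasStrictDerivAt 0 t).hasDerivAt

lemma addCocycle_sub_const (hh : Continuous h) (a t : ℝ) (x : M) :
    addCocycle f (fun y => h y - a) t x = addCocycle f h t x - t * a := by
  simp only [addCocycle]
  rw [intervalIntegral.integral_sub ((continuous_comp_flow hh x).intervalIntegrable _ _)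
    intervalIntegrable_const]
  simp

lemma addCocycle_neg (t : ℝ) (x : M) :
    addCocycle f (fun y => -h y) t x = -addCocycle f h t x :=
  intervalIntegral.integral_neg

lemma addCocycle_natCast_le_maxBirkhoffSum (hh : Continuous h) (n : ℕ) (x : M) :
    addCocycle f h n x ≤ maxBirkhoffSum (f 1) (addCocycle f h 1) n x := by
  induction n generalizing x with
  | zero => simp [addCocycle, maxBirkhoffSum]
  | succ n ih =>
    rw [Nat.cast_succ, add_comm, addCocycle_add hh]
    exact le_max_of_le_left (by linarith [ih (f 1 x)])

/-- The additive cocycle of a time change is inverted by the additive cocycle of the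
reciprocal multiplier over the original flow. -/
lemma addCocycle_inv_addCocycle (hγ : Continuous γ) (hpos : ∀ x, 0 < γ x)
    (hg : IsTimeChange f g γ) (t : ℝ) (x : M) :
    addCocycle f (fun y => (γ y)⁻¹) (addCocycle g γ t x) x = t := by
  have hi : Continuous fun y => (γ y)⁻¹ := hγ.inv₀ fun y => (hpos y).ne'
  have hd : ∀ t, HasDerivAt
      (fun t => addCocycle f (fun y => (γ y)⁻¹) (addCocycle g γ t x) x - t) 0 t := by
    intro t
    have h1 := ((hasDerivAt_addCocycle (f := f) hi (addCocycle g γ t x) x).comp t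
      (hasDerivAt_addCocycle (f := g) hγ t x)).sub (hasDerivAt_id t)
    rw [← hg t x, inv_mul_cancel₀ (hpos _).ne', sub_self] at h1
    exact h1
  have hconst := is_const_of_deriv_eq_zero (fun t => (hd t).differentiableAt)
    (fun t => (hd t).deriv) t 0
  simp only [addCocycle, intervalIntegral.integral_same, sub_zero] at hconst ⊢
  linarith

end FlowIntegrals

section Birkhoff

variable {M : Type*} [MetricSpace M] [CompactSpace M] [MeasurableSpace M] [BorelSpace M]
  {f : Flow ℝ M} {h : M → ℝ} {ν : Measure M}

lemma Continuous.integrable_of_finite [IsFiniteMeasure ν] (hh : Continuous h) :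
    Integrable h ν :=
  hh.integrable_of_hasCompactSupport (HasCompactSupport.of_compactSpace h)

lemma integral_addCocycle_one [IsFiniteMeasure ν] (hinv : ∀ t : ℝ, MeasurePreserving (f t) ν ν)
    (hh : Continuous h) : ∫ x, addCocycle f h 1 x ∂ν = ∫ x, h x ∂ν := by
  obtain ⟨C, hC⟩ := hh.exists_abs_le
  have hint : Integrable (Function.uncurry fun (s : ℝ) (x : M) => h (f s x))
      ((volume.restrict (Set.uIoc 0 1)).prod ν) := by
    have : IsFiniteMeasure ((volume : Measure ℝ).restrict (Set.uIoc 0 1)) :=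
      ⟨by simp [Set.uIoc]⟩
    refine Integrable.of_bound
      (hh.comp (f.continuous continuous_fst continuous_snd)).aestronglyMeasurable C ?_
    exact Eventually.of_forall fun p => hC _
  have hT : ∀ s, ∫ x, h (f s x) ∂ν = ∫ x, h x ∂ν := fun s => by
    rw [← integral_map (hinv s).measurable.aemeasurable
      hh.aestronglyMeasurable, (hinv s).map_eq]
  simp only [addCocycle]
  rw [← intervalIntegral_integral_swap hint]
  simp [hT]

/-- For an ergodic flow, the integrals along orbits of a continuous function of negative mean are
almost surely bounded above along integer times. -/
lemma ae_exists_addCocycle_natCast_le [IsProbabilityMeasure ν]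
    (hinv : ∀ t : ℝ, MeasurePreserving (f t) ν ν)
    (herg : ∀ J : Set M, MeasurableSet J → (∀ t : ℝ, f t '' J = J) → ν J = 0 ∨ ν J = 1)
    (hh : Continuous h) (hneg : ∫ x, h x ∂ν < 0) :
    ∀ᵐ x ∂ν, ∃ K : ℝ, ∀ n : ℕ, addCocycle f h n x ≤ K := by
  obtain ⟨C, hC⟩ := hh.exists_abs_le
  set E : Set M := {x | ∀ K : ℕ, ∃ n : ℕ, (K : ℝ) < addCocycle f h n x} with hE
  have hEm : MeasurableSet E := by
    have : E = ⋂ K : ℕ, ⋃ n : ℕ, {x | (K : ℝ) < addCocycle f h n x} := by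
      ext x; simp [hE]
    rw [this]
    exact .iInter fun K => .iUnion fun n =>
      measurableSet_lt measurable_const (continuous_addCocycle hh n).measurable
  have hEinv : ∀ t : ℝ, f t '' E = E := by
    rw [← f.isInvariant_iff_image_eq]
    intro t x hx K
    obtain ⟨L, hL⟩ := exists_nat_gt (K + 2 * (C * |t|))
    obtain ⟨n, hn⟩ := hx L
    refine ⟨n, ?_⟩
    have e1 := addCocycle_add (f := f) hh t n x
    have e2 := addCocycle_add (f := f) hh n t x
    have b1 := abs_le.1 (abs_addCocycle_le (f := f) hC t x)
    have b2 := abs_le.1 (abs_addCocycle_le (f := f) hC t (f n x))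
    rw [add_comm, e2] at e1
    linarith [b1.1, b1.2, b2.1, b2.2]
  have hE0 : ν E = 0 := by
    refine (herg E hEm hEinv).resolve_right fun h1 => ?_
    have hae : ∀ᵐ x ∂ν, x ∈ E := by
      rwa [← prob_compl_eq_zero_iff hEm] at h1
    have hc := continuous_addCocycle (f := f) hh 1
    have := integral_nonneg_of_ae_exists_maxBirkhoffSum_pos (hinv 1) hc.measurable
      hc.integrable_of_finite (by
        filter_upwards [hae] with x hx
        obtain ⟨n, hn⟩ := hx 0
        refine ⟨n, lt_of_lt_of_le ?_ (addCocycle_natCast_le_maxBirkhoffSum hh n x)⟩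
        simpa using hn)
    rw [integral_addCocycle_one hinv hh] at this
    linarith
  have hnot : ∀ᵐ x ∂ν, x ∉ E := measure_eq_zero_iff_ae_notMem.1 hE0
  filter_upwards [hnot] with x hx
  simp only [hE, Set.mem_ofPred_eq, not_forall, not_exists, not_lt] at hx
  obtain ⟨K, hK⟩ := hx
  exact ⟨K, hK⟩

lemma ae_exists_addCocycle_le [IsProbabilityMeasure ν]
    (hinv : ∀ t : ℝ, MeasurePreserving (f t) ν ν)
    (herg : ∀ J : Set M, MeasurableSet J → (∀ t : ℝ, f t '' J = J) → ν J = 0 ∨ ν J = 1)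
    (hh : Continuous h) (hneg : ∫ x, h x ∂ν < 0) :
    ∀ᵐ x ∂ν, ∃ K : ℝ, ∀ t : ℝ, 0 ≤ t → addCocycle f h t x ≤ K := by
  obtain ⟨C, hC⟩ := hh.exists_abs_le
  filter_upwards [ae_exists_addCocycle_natCast_le hinv herg hh hneg] with x ⟨K, hK⟩
  refine ⟨K + C, fun t ht => ?_⟩
  have e := addCocycle_add (f := f) hh (⌊t⌋₊ : ℝ) (t - ⌊t⌋₊) x
  rw [add_sub_cancel] at e
  have b := abs_le.1 (abs_addCocycle_le (f := f) hC (t - ⌊t⌋₊) (f (⌊t⌋₊ : ℝ) x))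
  have hC0 : 0 ≤ C := (abs_nonneg _).trans (hC x)
  have h1 : |t - ⌊t⌋₊| ≤ 1 := by
    rw [abs_le]
    constructor <;> linarith [Nat.floor_le ht, Nat.lt_floor_add_one t]
  have h2 : C * |t - ⌊t⌋₊| ≤ C := mul_le_of_le_one_right hC0 h1
  linarith [hK ⌊t⌋₊, b.2]

lemma ae_eventually_addCocycle_div_lt [IsProbabilityMeasure ν]
    (hinv : ∀ t : ℝ, MeasurePreserving (f t) ν ν)
    (herg : ∀ J : Set M, MeasurableSet J → (∀ t : ℝ, f t '' J = J) → ν J = 0 ∨ ν J = 1)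
    (hh : Continuous h) :
    ∀ᵐ x ∂ν, ∀ b, ∫ y, h y ∂ν < b → ∀ᶠ t in atTop, addCocycle f h t x / t < b := by
  have key : ∀ q : ℚ, ∫ y, h y ∂ν < q → ∀ᵐ x ∂ν, ∃ K : ℝ, ∀ t : ℝ, 0 ≤ t →
      addCocycle f h t x - t * q ≤ K := by
    intro q hq
    have hc : Continuous fun y => h y - q := hh.sub continuous_const
    have hneg : ∫ y, (h y - q) ∂ν < 0 := by
      rw [integral_sub hh.integrable_of_finite (integrable_const _)]
      simpa using hq
    filter_upwards [ae_exists_addCocycle_le hinv herg hc hneg] with x ⟨K, hK⟩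
    exact ⟨K, fun t ht => by simpa only [addCocycle_sub_const hh] using hK t ht⟩
  have key' : ∀ᵐ x ∂ν, ∀ q : ℚ, ∫ y, h y ∂ν < q → ∃ K : ℝ, ∀ t : ℝ, 0 ≤ t →
      addCocycle f h t x - t * q ≤ K := by
    rw [ae_all_iff]
    intro q
    by_cases hq : ∫ y, h y ∂ν < q
    · filter_upwards [key q hq] with x hx _ using hx
    · exact Eventually.of_forall fun x hx => absurd hx hq
  filter_upwards [key'] with x hx b hb
  obtain ⟨q, hq, hqb⟩ := exists_rat_btwn hb
  obtain ⟨K, hK⟩ := hx q hq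
  filter_upwards [eventually_gt_atTop 0, eventually_gt_atTop (K / (b - q))] with t ht htK
  rw [div_lt_iff₀ (sub_pos.2 hqb)] at htK
  rw [div_lt_iff₀ ht]
  linarith [hK t ht.le]

/-- Birkhoff's theorem for continuous functions over an ergodic continuous flow. -/
theorem ae_tendsto_addCocycle_div [IsProbabilityMeasure ν]
    (hinv : ∀ t : ℝ, MeasurePreserving (f t) ν ν)
    (herg : ∀ J : Set M, MeasurableSet J → (∀ t : ℝ, f t '' J = J) → ν J = 0 ∨ ν J = 1)
    (hh : Continuous h) :
    ∀ᵐ x ∂ν, Tendsto (fun t => addCocycle f h t x / t) atTop (𝓝 (∫ y, h y ∂ν)) := by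
  filter_upwards [ae_eventually_addCocycle_div_lt hinv herg hh,
    ae_eventually_addCocycle_div_lt hinv herg (h := fun y => -h y) hh.neg] with x h1 h2
  refine tendsto_order.2 ⟨fun a ha => ?_, h1⟩
  filter_upwards [h2 (-a) (by rw [MeasureTheory.integral_neg]; linarith)] with t ht
  rw [addCocycle_neg, neg_div] at ht
  linarith

end Birkhoff

lemma tendsto_addCocycle_atTop {M : Type*} [TopologicalSpace M] [CompactSpace M]
    {g : Flow ℝ M} {γ : M → ℝ} (hγ : Continuous γ) (hpos : ∀ x, 0 < γ x) (x : M) :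
    Tendsto (fun t => addCocycle g γ t x) atTop atTop := by
  obtain ⟨x₀, -, hmin⟩ := isCompact_univ.exists_isMinOn ⟨x, trivial⟩ hγ.continuousOn
  refine tendsto_atTop_mono' _ ?_ (tendsto_id.atTop_mul_const (hpos x₀))
  filter_upwards [eventually_ge_atTop 0] with t ht
  have := intervalIntegral.integral_mono_on ht (intervalIntegrable_const (μ := volume) (c := γ x₀))
    ((continuous_comp_flow (f := g) hγ x).intervalIntegrable 0 t)
    (fun s _ => hmin (Set.mem_univ _))
  simpa [addCocycle] using this

/-- Lyapunov exponents under time change: if `A` is a continuous linear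
cocycle over the flow `f`, `g` the time change with multiplier `γ`, `B^t_x = A^{τ(t,x)}_x`
the time-changed cocycle, and for `ν`-a.e. `x` the `i`-th singular-value exponent of `A`
is `λ`, then for `ν^γ`-a.e. `x` the `i`-th singular-value exponent of `B` (along integer
times) is `λ · (∫ γ⁻¹ dν)⁻¹`. -/
theorem stmt9 {M : Type*} [MetricSpace M] [CompactSpace M]
    [MeasurableSpace M] [BorelSpace M]
    (k : ℕ) (f g : Flow ℝ M)
    (A : ℝ → M → (EuclideanSpace ℝ (Fin k) →L[ℝ] EuclideanSpace ℝ (Fin k)))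
    (hAcont : Continuous fun p : ℝ × M => A p.1 p.2)
    (hA0 : ∀ x, A 0 x = ContinuousLinearMap.id ℝ (EuclideanSpace ℝ (Fin k)))
    (hAcoc : ∀ s t : ℝ, ∀ x : M, A (t + s) x = (A s (f t x)).comp (A t x))
    (hAinv : ∀ t x, IsUnit (A t x))
    (γ : M → ℝ) (hγc : Continuous γ) (hγpos : ∀ x, 0 < γ x)
    (hg : IsTimeChange f g γ)
    (ν : Measure M) [IsProbabilityMeasure ν]
    (hinv : ∀ t : ℝ, MeasurePreserving (f t) ν ν)
    (herg : ∀ J : Set M, MeasurableSet J → (∀ t : ℝ, f t '' J = J) → ν J = 0 ∨ ν J = 1)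
    (i : ℕ) (hi : 1 ≤ i) (hik : i ≤ k) (lam : ℝ)
    (hae : ∀ᵐ x ∂ν, Tendsto (fun t : ℝ => (1 / t) *
        Real.log (singularValue
          (A t x : EuclideanSpace ℝ (Fin k) →ₗ[ℝ] EuclideanSpace ℝ (Fin k)) i))
      atTop (𝓝 lam)) :
    ∀ᵐ x ∂(nuGamma ν γ), Tendsto (fun n : ℕ => (1 / (n : ℝ)) *
        Real.log (singularValue
          (A (addCocycle g γ n x) x : EuclideanSpace ℝ (Fin k) →ₗ[ℝ] EuclideanSpace ℝ (Fin k)) i))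
      atTop (𝓝 (lam * (∫ y, (γ y)⁻¹ ∂ν)⁻¹)) := by
  have hγinv : Continuous fun y => (γ y)⁻¹ := hγc.inv₀ fun y => (hγpos y).ne'
  have hIpos : 0 < ∫ y, (γ y)⁻¹ ∂ν := by
    rw [integral_pos_iff_support_of_nonneg (fun y => (inv_pos.2 (hγpos y)).le)
      hγinv.integrable_of_finite]
    have : Function.support (fun y => (γ y)⁻¹) = Set.univ :=
      Set.eq_univ_of_forall fun y => (inv_pos.2 (hγpos y)).ne'
    simp [this]
  refine (withDensity_absolutelyContinuous ν _).ae_le ?_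
  filter_upwards [hae, ae_tendsto_addCocycle_div hinv herg hγinv] with x hx hB
  have hτ : Tendsto (fun n : ℕ => addCocycle g γ n x) atTop atTop :=
    (tendsto_addCocycle_atTop hγc hγpos x).comp tendsto_natCast_atTop_atTop
  refine ((hx.comp hτ).mul ((hB.comp hτ).inv₀ hIpos.ne')).congr' ?_
  filter_upwards [hτ.eventually_gt_atTop 0] with n hn
  simp only [Function.comp_apply, addCocycle_inv_addCocycle hγc hγpos hg, inv_div]
  field_simp
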